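/- Let Gt = (V, E, {f_v}) be a general threshold instance whose underlying graph G = (V, E) is a layered graph with layers V_1, …, V_m. If f_v is AD-k for every node v ∈ V (Gt is locally AD-k), then the spread function σ is AD-k (Gt is globally AD-k). -/

import Mathlib

open MeasureTheory Finset
open scoped Classical

noncomputable section


/-- The difference of a set function `f` over a set `A`, evaluated at `S`:
`Δ_A f(S) = ∑_{B ⊆ A} (-1)^{|B|} f(S ∪ (A \ B))`. -/
def adDiff {V : Type*} [DecidableEq V] (f : Finset V → ℝ) (A S : Finset V) : ℝ :=
  ∑ B ∈ A.powerset, (-1 : ℝ) ^ B.card * f (S ∪ (A \ B))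

/-- A set function `f : 2^V → ℝ` is AD-`k` if `(-1)^{|A|+1} Δ_A f(S) ≥ 0` for every
nonempty `A` with `|A| ≤ k` and every `S`. -/
def IsADk {V : Type*} [DecidableEq V] (f : Finset V → ℝ) (k : ℕ) : Prop :=
  ∀ A S : Finset V, A.Nonempty → A.card ≤ k →
    0 ≤ (-1 : ℝ) ^ (A.card + 1) * adDiff f A S



/-- A general threshold instance on a finite directed graph `(V, E)`:
each node `v` has a threshold function `f v : 2^V → [0,1]` that is monotone,
vanishes on `∅`, and depends only on the in-neighbors of `v`. -/
structure GTInstance (V : Type*) [Fintype V] [DecidableEq V] where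
  E : V → V → Prop
  f : V → Finset V → ℝ
  f_nonneg : ∀ v S, 0 ≤ f v S
  f_le_one : ∀ v S, f v S ≤ 1
  f_mono : ∀ v, Monotone (f v)
  f_empty : ∀ v, f v ∅ = 0
  f_local : ∀ v S, f v S = f v (S.filter fun u => E u v)

variable {V : Type*} [Fintype V] [DecidableEq V]

/-- The deterministic cascade for threshold vector `θ` and seed set `S`:
`C_0 = S`, `C_{t+1} = C_t ∪ {v : f_v(C_t) ≥ θ_v}`. -/
def cascade (gt : GTInstance V) (θ : V → ℝ) (S : Finset V) : ℕ → Finset V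
  | 0 => S
  | t + 1 =>
      cascade gt θ S t ∪ Finset.univ.filter fun v => θ v ≤ gt.f v (cascade gt θ S t)

/-- The final active set of the cascade. -/
def finalSet (gt : GTInstance V) (θ : V → ℝ) (S : Finset V) : Finset V :=
  cascade gt θ S (Fintype.card V)

/-- The uniform (Lebesgue product) probability measure on `[0,1]^V`. -/
def cubeMeasure (V : Type*) [Fintype V] : Measure (V → ℝ) :=
  Measure.pi fun _ => volume.restrict (Set.Icc 0 1)

/-- `activationProb gt v S` is the probability (over uniform thresholds) that `v`
is active at the end of the diffusion started from seed set `S`. -/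
def activationProb (gt : GTInstance V) (v : V) (S : Finset V) : ℝ :=
  (cubeMeasure V {θ | v ∈ finalSet gt θ S}).toReal

/-- The spread function `σ(S) = ∑_{v ∈ V} P_v(S)`. -/
def spread (gt : GTInstance V) (S : Finset V) : ℝ :=
  ∑ v : V, activationProb gt v S

/-- The underlying graph is a layered graph with `m ≥ 2` layers (layer indices `1, …, m`),
all edges going from a node of layer `i+1` to a node of layer `i`. -/
def IsLayered (gt : GTInstance V) (m : ℕ) (layer : V → ℕ) : Prop :=
  2 ≤ m ∧ (∀ v, 1 ≤ layer v ∧ layer v ≤ m) ∧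
    ∀ u v, gt.E u v → layer u = layer v + 1

/-- The underlying graph is a directed acyclic graph (no directed cycles). -/
def IsDAG (gt : GTInstance V) : Prop := ∀ v, ¬ Relation.TransGen gt.E v v


theorem adDiff_empty' {V : Type*} [DecidableEq V] (f : Finset V → ℝ) (S : Finset V) :
    adDiff f ∅ S = f S := by
  simp [adDiff]

theorem adDiff_insert' {V : Type*} [DecidableEq V] (f : Finset V → ℝ) (a : V) (A S : Finset V)
    (ha : a ∉ A) : adDiff f (insert a A) S = adDiff f A (insert a S) - adDiff f A S := by
  unfold adDiff
  rw [Finset.sum_powerset_insert ha, sub_eq_add_neg, ← Finset.sum_neg_distrib]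
  congr 1
  · apply Finset.sum_congr rfl
    intro B hB
    rw [Finset.mem_powerset] at hB
    have : S ∪ (insert a A \ B) = insert a S ∪ (A \ B) := by
      ext x
      have := @hB x
      simp only [Finset.mem_union, Finset.mem_sdiff, Finset.mem_insert]
      by_cases hx : x = a
      · subst hx; tauto
      · tauto
    rw [this]
  · apply Finset.sum_congr rfl
    intro B hB
    rw [Finset.mem_powerset] at hB
    have h1 : a ∉ B := fun h => ha (hB h)
    have : S ∪ (insert a A \ insert a B) = S ∪ (A \ B) := by
      ext x
      simp only [Finset.mem_union, Finset.mem_sdiff, Finset.mem_insert]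
      by_cases hx : x = a
      · subst hx; tauto
      · tauto
    rw [this, Finset.card_insert_of_notMem h1, pow_succ]
    ring

theorem adDiff_sub' {V : Type*} [DecidableEq V] (f g : Finset V → ℝ) (A S : Finset V) :
    adDiff (fun T => f T - g T) A S = adDiff f A S - adDiff g A S := by
  simp only [adDiff, mul_sub, Finset.sum_sub_distrib]

theorem adDiff_sum' {V ι : Type*} [DecidableEq V] (s : Finset ι) (f : ι → Finset V → ℝ)
    (A S : Finset V) :
    adDiff (fun T => ∑ i ∈ s, f i T) A S = ∑ i ∈ s, adDiff (f i) A S := by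
  simp only [adDiff, Finset.mul_sum]
  rw [Finset.sum_comm]

theorem adDiff_shift' {V : Type*} [DecidableEq V] (g : Finset V → ℝ) (v : V) (A S : Finset V) :
    adDiff (fun T => g (insert v T)) A S = adDiff g A (insert v S) := by
  simp only [adDiff, Finset.insert_union]

theorem adDiff_mem_zero' {V : Type*} [DecidableEq V] (g : Finset V → ℝ) (v : V) (A S : Finset V)
    (hv : v ∈ A) : adDiff g A (insert v S) = 0 := by
  rw [← Finset.insert_erase hv, adDiff_insert' _ _ _ _ (Finset.notMem_erase v A)]
  simp

theorem adDiff_invariant' {V : Type*} [DecidableEq V] (g : Finset V → ℝ) (v : V) (A S : Finset V)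
    (hv : v ∈ A) (hg : ∀ T, g (insert v T) = g T) : adDiff g A S = 0 := by
  rw [← adDiff_mem_zero' g v A S hv, ← adDiff_shift']
  simp only [hg]

theorem adDiff_mul' {V : Type*} [DecidableEq V] (p q : Finset V → ℝ) (A : Finset V) :
    ∀ S, adDiff (fun T => p T * q T) A S =
      ∑ B ∈ A.powerset, adDiff p B S * adDiff q (A \ B) (S ∪ B) := by
  induction A using Finset.induction_on with
  | empty => intro S; simp [adDiff_empty']
  | insert a A ha ih =>
    intro S
    rw [adDiff_insert' _ _ _ _ ha, ih, ih, Finset.sum_powerset_insert ha,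
      ← Finset.sum_sub_distrib, ← Finset.sum_add_distrib]
    apply Finset.sum_congr rfl
    intro B hB
    rw [Finset.mem_powerset] at hB
    have h1 : a ∉ B := fun h => ha (hB h)
    have e1 : insert a A \ B = insert a (A \ B) := Finset.insert_sdiff_of_notMem _ h1
    have e2 : insert a A \ insert a B = A \ B := by
      ext x
      simp only [Finset.mem_sdiff, Finset.mem_insert]
      by_cases hx : x = a
      · subst hx; tauto
      · tauto
    have h2 : a ∉ A \ B := fun h => ha (Finset.mem_sdiff.1 h).1
    rw [e1, e2, adDiff_insert' _ _ _ _ h2, adDiff_insert' _ _ _ _ h1, Finset.union_insert,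
      Finset.insert_union]
    ring

/-- One-node update operator. -/
def stepOp {V : Type*} [DecidableEq V] (f : Finset V → ℝ) (v : V) (g : Finset V → ℝ) :
    Finset V → ℝ :=
  fun S => f S * g (insert v S) + (1 - f S) * g S

theorem stepOp_ADk {V : Type*} [DecidableEq V] (f : Finset V → ℝ) (v : V) (g : Finset V → ℝ)
    (k : ℕ) (h0 : ∀ S, 0 ≤ f S) (h1 : ∀ S, f S ≤ 1) (hf : IsADk f k) (hg : IsADk g k) :
    IsADk (stepOp f v g) k := by
  set d : Finset V → ℝ := fun T => g (insert v T) - g T with hd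
  set p : Finset V → ℝ := fun T => 1 - f T with hp
  have hstep : stepOp f v g = fun T => g (insert v T) - p T * d T := by
    funext T; simp only [stepOp, hd, hp]; ring
  have dDiff : ∀ A S, adDiff d A S = adDiff g A (insert v S) - adDiff g A S := by
    intro A S
    rw [hd, adDiff_sub' (fun T => g (insert v T)) g, adDiff_shift']
  have pCM : ∀ A S, A.card ≤ k → 0 ≤ (-1 : ℝ) ^ A.card * adDiff p A S := by
    intro A S hA
    rcases A.eq_empty_or_nonempty with rfl | hne
    · simp [adDiff_empty', hp, h1]
    · have := hf A S hne hA
      obtain ⟨a, ha⟩ := hne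
      rw [hp, adDiff_sub' (fun _ => 1) f, adDiff_invariant' (fun _ => (1:ℝ)) a A S ha (fun _ => rfl)]
      rw [pow_succ] at this
      linarith
  have dCM : ∀ A S, A.card < k → 0 ≤ (-1 : ℝ) ^ A.card * adDiff d A S := by
    intro A S hA
    by_cases hv : v ∈ A
    · rw [dDiff, adDiff_mem_zero' g v A S hv]
      have := hg A S ⟨v, hv⟩ hA.le
      rw [pow_succ] at this
      linarith
    · rw [dDiff, ← adDiff_insert' g v A S hv]
      have := hg (insert v A) S ⟨v, Finset.mem_insert_self v A⟩
        (by rw [Finset.card_insert_of_notMem hv]; omega)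
      rw [Finset.card_insert_of_notMem hv, pow_succ, pow_succ] at this
      linarith
  intro A S hne hA
  rw [hstep, adDiff_sub' (fun T => g (insert v T)) (fun T => p T * d T), adDiff_shift',
    adDiff_mul', ← Finset.add_sum_erase _ _ (Finset.empty_mem_powerset A)]
  rw [adDiff_empty', Finset.sdiff_empty, Finset.union_empty, dDiff]
  have hrest : 0 ≤ (-1 : ℝ) ^ A.card *
      ∑ B ∈ A.powerset.erase ∅, adDiff p B S * adDiff d (A \ B) (S ∪ B) := by
    rw [Finset.mul_sum]
    apply Finset.sum_nonneg
    intro B hB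
    rw [Finset.mem_erase, Finset.mem_powerset] at hB
    have hBpos : 0 < B.card := Finset.card_pos.2 (Finset.nonempty_iff_ne_empty.2 hB.1)
    have hc : (A \ B).card + B.card = A.card := Finset.card_sdiff_add_card_eq_card hB.2
    have a1 := pCM B S (by omega)
    have a2 := dCM (A \ B) (S ∪ B) (by omega)
    have := mul_nonneg a1 a2
    rw [← hc, pow_add]
    linarith
  have g1 := hg A S hne hA
  have g2 := hg A (insert v S) hne hA
  have g3 := mul_nonneg (h0 S) g2
  have g4 := mul_nonneg (sub_nonneg.2 (h1 S)) g1
  rw [pow_succ] at *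
  simp only [hp] at *
  linarith

theorem indicator_ADk {V : Type*} [DecidableEq V] (v : V) (k : ℕ) :
    IsADk (fun S : Finset V => if v ∈ S then (1:ℝ) else 0) k := by
  intro A S hne _
  by_cases h : ∃ a ∈ A, a ≠ v
  · obtain ⟨a, ha, hav⟩ := h
    rw [adDiff_invariant' _ a A S ha]
    · simp
    · intro T
      simp [Ne.symm hav]
  · push Not at h
    have : A = {v} := Finset.eq_singleton_iff_nonempty_unique_mem.2 ⟨hne, h⟩
    subst this
    have e : ({v} : Finset V) = insert v ∅ := by simp
    rw [e, adDiff_insert' _ _ _ _ (by simp), adDiff_empty', adDiff_empty']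
    by_cases hv : v ∈ S <;> simp [hv]

/-- Sequential processing of the nodes of a list. -/
def runList (gt : GTInstance V) (θ : V → ℝ) : List V → Finset V → Finset V
  | [], S => S
  | v :: l, S => runList gt θ l (if θ v ≤ gt.f v S then insert v S else S)

def runOp (gt : GTInstance V) (g : Finset V → ℝ) : List V → Finset V → ℝ
  | [] => g
  | v :: l => stepOp (gt.f v) v (runOp gt g l)

theorem runOp_ADk (gt : GTInstance V) (k : ℕ) (hloc : ∀ v, IsADk (gt.f v) k)
    (g : Finset V → ℝ) (hg : IsADk g k) (l : List V) : IsADk (runOp gt g l) k := by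
  induction l with
  | nil => exact hg
  | cons v l ih =>
    exact stepOp_ADk _ _ _ _ (gt.f_nonneg v) (gt.f_le_one v) (hloc v) ih

theorem runList_spec (gt : GTInstance V) (layer : V → ℕ)
    (hE : ∀ u v, gt.E u v → layer u = layer v + 1) (θ : V → ℝ) (l : List V) :
    ∀ S, l.Nodup → l.Pairwise (fun a b => layer b ≤ layer a) →
      (S ⊆ runList gt θ l S) ∧ (∀ w ∈ runList gt θ l S, w ∈ S ∨ w ∈ l) ∧
      ∀ w ∈ l, (w ∈ runList gt θ l S ↔ w ∈ S ∨ θ w ≤ gt.f w (runList gt θ l S)) := by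
  induction l with
  | nil => intro S _ _; simp [runList]
  | cons v l ih =>
    intro S hnd hpw
    rw [List.nodup_cons] at hnd
    rw [List.pairwise_cons] at hpw
    rw [runList]
    set S' : Finset V := if θ v ≤ gt.f v S then insert v S else S with hS'
    obtain ⟨i1, i2, i3⟩ := ih S' hnd.2 hpw.2
    have hmem : ∀ w, w ∈ S' ↔ w ∈ S ∨ (w = v ∧ θ v ≤ gt.f v S) := by
      intro w
      rw [hS']
      split_ifs with h
      · simp [h, or_comm]
      · simp [h]
    set R := runList gt θ l S' with hR
    have j1 : S ⊆ R := fun w hw => i1 ((hmem w).2 (Or.inl hw))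
    have j2 : ∀ w ∈ R, w ∈ S ∨ w ∈ v :: l := by
      intro w hw
      rw [List.mem_cons]
      rcases i2 w hw with h | h
      · rcases (hmem w).1 h with h | h
        · exact Or.inl h
        · exact Or.inr (Or.inl h.1)
      · exact Or.inr (Or.inr h)
    have hf : gt.f v R = gt.f v S := by
      rw [gt.f_local v R, gt.f_local v S]
      congr 1
      ext u
      simp only [Finset.mem_filter]
      constructor
      · rintro ⟨hu, he⟩
        refine ⟨?_, he⟩
        rcases j2 u hu with h | h
        · exact h
        · exfalso
          have := hE u v he
          rw [List.mem_cons] at h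
          rcases h with h | h
          · subst h; omega
          · have := hpw.1 u h; omega
      · rintro ⟨hu, he⟩
        exact ⟨j1 hu, he⟩
    refine ⟨j1, j2, ?_⟩
    intro w hw
    rw [List.mem_cons] at hw
    by_cases hwv : w = v
    · subst hwv
      rw [hf]
      constructor
      · intro h
        rcases i2 w h with h | h
        · rcases (hmem w).1 h with h | h
          · exact Or.inl h
          · exact Or.inr h.2
        · exact absurd h hnd.1
      · rintro (h | h)
        · exact j1 h
        · exact i1 ((hmem w).2 (Or.inr ⟨rfl, h⟩))
    · have hwl : w ∈ l := by tauto
      rw [i3 w hwl, hmem w]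
      simp [hwv]

theorem cascade_mem (gt : GTInstance V) (θ : V → ℝ) (S : Finset V) (t : ℕ) :
    ∀ w ∈ cascade gt θ S t, w ∈ S ∨ θ w ≤ gt.f w (cascade gt θ S t) := by
  induction t with
  | zero => intro w hw; exact Or.inl hw
  | succ t ih =>
    intro w hw
    have hsub : cascade gt θ S t ⊆ cascade gt θ S (t+1) := by
      rw [cascade]; exact Finset.subset_union_left
    rw [cascade, Finset.mem_union] at hw
    rcases hw with h | h
    · rcases ih w h with h | h
      · exact Or.inl h
      · exact Or.inr (h.trans (gt.f_mono w hsub))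
    · exact Or.inr ((Finset.mem_filter.1 h).2.trans (gt.f_mono w hsub))

theorem cascade_stab (gt : GTInstance V) (θ : V → ℝ) (S : Finset V) (t : ℕ) :
    cascade gt θ S (t+1) = cascade gt θ S t ∨ t + 1 ≤ (cascade gt θ S (t+1)).card := by
  induction t with
  | zero =>
    by_cases h : cascade gt θ S (0+1) = cascade gt θ S 0
    · exact Or.inl h
    · right
      have hsub : cascade gt θ S 0 ⊂ cascade gt θ S (0+1) := by
        refine lt_of_le_of_ne ?_ (Ne.symm h)
        rw [cascade]; exact Finset.subset_union_left
      have := Finset.card_lt_card hsub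
      omega
  | succ t ih =>
    by_cases h : cascade gt θ S (t+1+1) = cascade gt θ S (t+1)
    · exact Or.inl h
    · right
      have hsub : cascade gt θ S (t+1) ⊂ cascade gt θ S (t+1+1) := by
        refine lt_of_le_of_ne ?_ (Ne.symm h)
        conv_rhs => rw [cascade]
        exact Finset.subset_union_left
      have := Finset.card_lt_card hsub
      rcases ih with ih | ih
      · exfalso
        apply h
        conv_lhs => rw [cascade, ih]
        rw [cascade]
      · omega

theorem finalSet_spec (gt : GTInstance V) (θ : V → ℝ) (S : Finset V) (w : V) :
    w ∈ finalSet gt θ S ↔ w ∈ S ∨ θ w ≤ gt.f w (finalSet gt θ S) := by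
  have hst : cascade gt θ S (Fintype.card V + 1) = cascade gt θ S (Fintype.card V) := by
    rcases cascade_stab gt θ S (Fintype.card V) with h | h
    · exact h
    · have := Finset.card_le_univ (cascade gt θ S (Fintype.card V + 1))
      omega
  constructor
  · exact cascade_mem gt θ S _ w
  · rintro (h | h)
    · have : ∀ t, w ∈ cascade gt θ S t := by
        intro t
        induction t with
        | zero => exact h
        | succ t ih => rw [cascade]; exact Finset.mem_union_left _ ih
      exact this _
    · unfold finalSet
      rw [← hst, cascade]
      exact Finset.mem_union_right _ (Finset.mem_filter.2 ⟨Finset.mem_univ _, h⟩)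

theorem finalSet_eq_run (gt : GTInstance V) (m : ℕ) (layer : V → ℕ) (hlay : IsLayered gt m layer)
    (θ : V → ℝ) (S : Finset V) (l : List V) (hnd : l.Nodup) (hall : ∀ v, v ∈ l)
    (hpw : l.Pairwise (fun a b => layer b ≤ layer a)) :
    finalSet gt θ S = runList gt θ l S := by
  obtain ⟨_, hb, hE⟩ := hlay
  obtain ⟨_, _, h3⟩ := runList_spec gt layer hE θ l S hnd hpw
  have key : ∀ n w, m - layer w = n → (w ∈ finalSet gt θ S ↔ w ∈ runList gt θ l S) := by
    intro n
    induction n using Nat.strong_induction_on with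
    | _ n ih =>
      intro w hw
      rw [finalSet_spec, h3 w (hall w)]
      have : gt.f w (finalSet gt θ S) = gt.f w (runList gt θ l S) := by
        rw [gt.f_local w (finalSet gt θ S), gt.f_local w (runList gt θ l S)]
        congr 1
        ext u
        simp only [Finset.mem_filter]
        refine and_congr_left fun he => ?_
        have h4 := hE u w he
        have h5 := (hb u).2
        exact ih (m - layer u) (by omega) u rfl
      rw [this]
  ext w
  exact key _ w rfl

instance cubeMeasure_prob : IsProbabilityMeasure (cubeMeasure V) := by
  have : IsProbabilityMeasure ((volume : Measure ℝ).restrict (Set.Icc 0 1)) :=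
    ⟨by simp⟩
  unfold cubeMeasure
  infer_instance

theorem runList_measurable (gt : GTInstance V) (g : Finset V → ℝ) (l : List V) :
    ∀ S, Measurable (fun θ : V → ℝ => g (runList gt θ l S)) := by
  induction l with
  | nil => intro S; simp only [runList]; exact measurable_const
  | cons v l ih =>
    intro S
    have : (fun θ : V → ℝ => g (runList gt θ (v :: l) S)) = fun θ =>
        if θ v ≤ gt.f v S then g (runList gt θ l (insert v S)) else g (runList gt θ l S) := by
      funext θ
      rw [runList]
      split_ifs <;> rfl
    rw [this]
    exact Measurable.ite (measurableSet_le (measurable_pi_apply v) measurable_const)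
      (ih _) (ih _)

theorem runList_congr (gt : GTInstance V) (θ θ' : V → ℝ) (l : List V) :
    ∀ S, (∀ v ∈ l, θ v = θ' v) → runList gt θ l S = runList gt θ' l S := by
  induction l with
  | nil => intro S _; rfl
  | cons v l ih =>
    intro S h
    rw [runList, runList, h v (by simp), ih _ (fun w hw => h w (by simp [hw]))]

theorem runList_bdd (gt : GTInstance V) (g : Finset V → ℝ) (l : List V) (S : Finset V) :
    Integrable (fun θ : V → ℝ => g (runList gt θ l S)) (cubeMeasure V) := by
  refine Integrable.of_bound (runList_measurable gt g l S).aestronglyMeasurable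
    (∑ T, ‖g T‖) (Filter.Eventually.of_forall fun θ => ?_)
  exact Finset.single_le_sum (f := fun T => ‖g T‖) (fun _ _ => norm_nonneg _) (Finset.mem_univ _)

theorem coord_integral (v : V) (c : ℝ) (h0 : 0 ≤ c) (h1 : c ≤ 1) :
    ∫ θ : V → ℝ, (if θ v ≤ c then (1:ℝ) else 0) ∂(cubeMeasure V) = c := by
  have : IsProbabilityMeasure ((volume : Measure ℝ).restrict (Set.Icc 0 1)) :=
    ⟨by simp⟩
  have hmp : MeasurePreserving (Function.eval v) (cubeMeasure V)
      ((volume : Measure ℝ).restrict (Set.Icc 0 1)) :=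
    measurePreserving_eval (fun _ : V => (volume : Measure ℝ).restrict (Set.Icc 0 1)) v
  have hm : Measurable (fun x : ℝ => if x ≤ c then (1:ℝ) else 0) :=
    Measurable.ite measurableSet_Iic measurable_const measurable_const
  have e1 := integral_map (μ := cubeMeasure V) hmp.measurable.aemeasurable
    (f := fun x : ℝ => if x ≤ c then (1:ℝ) else 0) hm.aestronglyMeasurable
  rw [hmp.map_eq] at e1
  refine e1.symm.trans ?_
  have e2 : (fun x : ℝ => if x ≤ c then (1:ℝ) else 0) = (Set.Iic c).indicator (fun _ => 1) := by
    funext x; simp [Set.indicator]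
  rw [e2, integral_indicator measurableSet_Iic, Measure.restrict_restrict measurableSet_Iic]
  have e3 : Set.Iic c ∩ Set.Icc 0 1 = Set.Icc 0 c := by
    ext x
    simp only [Set.mem_inter_iff, Set.mem_Iic, Set.mem_Icc]
    constructor
    · rintro ⟨a, b, _⟩; exact ⟨b, a⟩
    · rintro ⟨a, b⟩; exact ⟨b, a, b.trans h1⟩
  rw [e3]
  simp [h0]

theorem indep_integral (gt : GTInstance V) (g : Finset V → ℝ) (l : List V) (S : Finset V) (v : V)
    (hv : v ∉ l) (c : ℝ) (h0 : 0 ≤ c) (h1 : c ≤ 1) :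
    ∫ θ : V → ℝ, (if θ v ≤ c then (1:ℝ) else 0) * g (runList gt θ l S) ∂(cubeMeasure V) =
      c * ∫ θ : V → ℝ, g (runList gt θ l S) ∂(cubeMeasure V) := by
  have : IsProbabilityMeasure ((volume : Measure ℝ).restrict (Set.Icc 0 1)) :=
    ⟨by simp⟩
  have hind : ProbabilityTheory.iIndepFun (fun (i : V) (θ : V → ℝ) => θ i) (cubeMeasure V) :=
    ProbabilityTheory.iIndepFun_pi (X := fun _ => id) (fun _ => aemeasurable_id)
  have hdisj : Disjoint ({v} : Finset V) (Finset.univ.erase v) := by simp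
  have hi2 := hind.indepFun_finset {v} (Finset.univ.erase v) hdisj (fun i => measurable_pi_apply i)
  let φ : (({v} : Finset V) → ℝ) → ℝ := fun y => if y ⟨v, by simp⟩ ≤ c then 1 else 0
  let ext : (↥(Finset.univ.erase v : Finset V) → ℝ) → (V → ℝ) :=
    fun y w => if h : w ∈ Finset.univ.erase v then y ⟨w, h⟩ else 0
  let ψ : (↥(Finset.univ.erase v : Finset V) → ℝ) → ℝ := fun y => g (runList gt (ext y) l S)
  have hφ : Measurable φ :=
    Measurable.ite (measurableSet_le (measurable_pi_apply _) measurable_const)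
      measurable_const measurable_const
  have hext : Measurable ext := by
    refine measurable_pi_lambda _ fun w => ?_
    by_cases h : w ∈ Finset.univ.erase v
    · simp only [ext, h, dif_pos]; exact measurable_pi_apply _
    · simp only [ext, h]; exact measurable_const
  have hψ : Measurable ψ := (runList_measurable gt g l S).comp hext
  have hi3 := hi2.comp hφ hψ
  have eψ : (ψ ∘ fun (θ : V → ℝ) (i : (Finset.univ.erase v : Finset V)) => θ i) =
      fun θ => g (runList gt θ l S) := by
    funext θ
    simp only [ψ, Function.comp]
    congr 1
    apply runList_congr
    intro w hw
    have : w ≠ v := fun h => hv (h ▸ hw)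
    simp [ext, this]
  have eφ : (φ ∘ fun (θ : V → ℝ) (i : ({v} : Finset V)) => θ i) =
      fun θ => if θ v ≤ c then (1:ℝ) else 0 := rfl
  rw [eψ, eφ] at hi3
  have := hi3.integral_fun_mul_eq_mul_integral
    (Measurable.ite (measurableSet_le (measurable_pi_apply v) measurable_const)
      measurable_const measurable_const).aestronglyMeasurable
    (runList_measurable gt g l S).aestronglyMeasurable
  rw [this, coord_integral v c h0 h1]

theorem run_integral (gt : GTInstance V) (g : Finset V → ℝ) (l : List V) :
    ∀ S, l.Nodup → ∫ θ : V → ℝ, g (runList gt θ l S) ∂(cubeMeasure V) = runOp gt g l S := by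
  induction l with
  | nil => intro S _; simp [runList, runOp]
  | cons v l ih =>
    intro S hnd
    rw [List.nodup_cons] at hnd
    set c := gt.f v S with hc
    have hm : Measurable (fun θ : V → ℝ => if θ v ≤ c then (1:ℝ) else 0) :=
      Measurable.ite (measurableSet_le (measurable_pi_apply v) measurable_const)
        measurable_const measurable_const
    have hint : ∀ T, Integrable
        (fun θ : V → ℝ => (if θ v ≤ c then (1:ℝ) else 0) * g (runList gt θ l T))
        (cubeMeasure V) := by
      intro T
      refine (runList_bdd gt g l T).bdd_mul (c := 1) hm.aestronglyMeasurable
        (Filter.Eventually.of_forall fun θ => ?_)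
      split_ifs <;> simp
    have e : (fun θ : V → ℝ => g (runList gt θ (v :: l) S)) = fun θ =>
        ((if θ v ≤ c then (1:ℝ) else 0) * g (runList gt θ l (insert v S)) +
          g (runList gt θ l S)) - (if θ v ≤ c then (1:ℝ) else 0) * g (runList gt θ l S) := by
      funext θ
      rw [runList]
      split_ifs <;> simp
    have h0 := gt.f_nonneg v S
    have h1 := gt.f_le_one v S
    have hadd : Integrable (fun θ : V → ℝ => (if θ v ≤ c then (1:ℝ) else 0) *
        g (runList gt θ l (insert v S)) + g (runList gt θ l S)) (cubeMeasure V) :=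
      (hint _).add (runList_bdd gt g l S)
    rw [e, integral_sub hadd (hint _),
      integral_add (hint _) (runList_bdd gt g l S),
      indep_integral gt g l _ v hnd.1 c h0 h1, indep_integral gt g l _ v hnd.1 c h0 h1,
      ih _ hnd.2, ih _ hnd.2, runOp, stepOp]
    ring

theorem activationProb_eq (gt : GTInstance V) (m : ℕ) (layer : V → ℕ)
    (hlay : IsLayered gt m layer) (l : List V) (hnd : l.Nodup) (hall : ∀ v, v ∈ l)
    (hpw : l.Pairwise (fun a b => layer b ≤ layer a)) (v : V) :
    activationProb gt v = runOp gt (fun S => if v ∈ S then (1:ℝ) else 0) l := by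
  funext S
  rw [← run_integral gt _ l S hnd]
  unfold activationProb
  have e : {θ : V → ℝ | v ∈ finalSet gt θ S} = {θ | v ∈ runList gt θ l S} := by
    ext θ
    simp only [Set.mem_setOf_eq, finalSet_eq_run gt m layer hlay θ S l hnd hall hpw]
  have hmeas : MeasurableSet {θ : V → ℝ | v ∈ runList gt θ l S} := by
    have := runList_measurable gt (fun S => if v ∈ S then (1:ℝ) else 0) l S
      (measurableSet_singleton 1)
    convert this using 1
    ext θ
    simp
  have e2 : (fun θ : V → ℝ => if v ∈ runList gt θ l S then (1:ℝ) else 0) =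
      {θ : V → ℝ | v ∈ runList gt θ l S}.indicator 1 := by
    funext θ; simp [Set.indicator]
  rw [e, e2, integral_indicator_one hmeas]
  rfl

/-- In the general threshold model on a layered graph, if every threshold function is
AD-`k` (locally AD-`k`), then the spread function `σ` is AD-`k` (globally AD-`k`). -/
theorem layered_locally_ADk_implies_globally_ADk
    {V : Type*} [Fintype V] [DecidableEq V] (gt : GTInstance V)
    (m : ℕ) (layer : V → ℕ) (hlay : IsLayered gt m layer) (k : ℕ)
    (hloc : ∀ v, IsADk (gt.f v) k) :
    IsADk (spread gt) k := by
  obtain ⟨l, hnd, hall, hpw⟩ : ∃ l : List V, l.Nodup ∧ (∀ v, v ∈ l) ∧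
      l.Pairwise (fun a b => layer b ≤ layer a) := by
    let r : V → V → Prop := fun a b => layer b ≤ layer a
    haveI : Std.Total r := ⟨fun a b => le_total (layer b) (layer a)⟩
    haveI : IsTrans V r := ⟨fun a b c h1 h2 => le_trans (b := layer b) h2 h1⟩
    refine ⟨(Finset.univ : Finset V).toList.insertionSort r, ?_, ?_, ?_⟩
    · exact (List.perm_insertionSort r _).nodup_iff.2 (Finset.nodup_toList _)
    · intro v
      exact (List.perm_insertionSort r _).mem_iff.2 (by simp)
    · exact List.pairwise_insertionSort r _
  intro A S hne hA
  have hs : spread gt = fun S => ∑ v : V, activationProb gt v S := rfl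
  rw [hs, adDiff_sum', Finset.mul_sum]
  refine Finset.sum_nonneg fun v _ => ?_
  rw [activationProb_eq gt m layer hlay l hnd hall hpw v]
  exact runOp_ADk gt k hloc _ (indicator_ADk v k) l A S hne hA

end
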